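/- Let f : 𝔻̄ → ℂ be continuous on the closed unit disk, holomorphic on the open disk. If f vanishes on a subset of the unit circle of positive Lebesgue (arc-length) measure, then f is identically zero. -/

import Mathlib

open MeasureTheory Real in
/-- Lower bound from Jensen's formula: the circle means of `log ‖f‖` are bounded below. -/
lemma jensen_lower (f : ℂ → ℂ) (hd : DifferentiableOn ℂ f (Metric.ball 0 1)) :
    ∃ C : ℝ, ∀ r ∈ Set.Ioo (1 / 2 : ℝ) 1, C ≤ circleAverage (fun z => log ‖f z‖) 0 r := by
  have ha : AnalyticOnNhd ℂ f (Metric.ball 0 1) := hd.analyticOnNhd Metric.isOpen_ball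
  refine ⟨((meromorphicOrderAt f 0).untop₀ : ℝ) * log (1 / 2)
    + log ‖meromorphicTrailingCoeffAt f 0‖, ?_⟩
  rintro r ⟨hr, hr1⟩
  have hr0 : 0 < r := by linarith
  have habs : |r| = r := abs_of_pos hr0
  have hsub : Metric.closedBall (0 : ℂ) |r| ⊆ Metric.ball 0 1 := by
    rw [habs]; exact Metric.closedBall_subset_ball hr1
  have har : AnalyticOnNhd ℂ f (Metric.closedBall 0 |r|) := ha.mono hsub
  have hJ := har.meromorphicOn.circleAverage_log_norm hr0.ne'
  have h0 : (0 : ℂ) ∈ Metric.closedBall (0 : ℂ) |r| := by simp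
  have hnn := MeromorphicOn.AnalyticOnNhd.divisor_nonneg har
  have hord : (0 : ℝ) ≤ ((meromorphicOrderAt f 0).untop₀ : ℝ) := by
    have := hnn 0
    rw [MeromorphicOn.divisor_apply har.meromorphicOn h0] at this
    exact_mod_cast this
  rw [hJ, MeromorphicOn.divisor_apply har.meromorphicOn h0]
  have hsum : 0 ≤ ∑ᶠ u, (MeromorphicOn.divisor f (Metric.closedBall 0 |r|) u : ℝ)
      * log (r * ‖0 - u‖⁻¹) := by
    apply finsum_nonneg
    intro u
    by_cases hu : u ∈ Metric.closedBall (0 : ℂ) |r|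
    · apply mul_nonneg
      · exact_mod_cast hnn u
      · by_cases hu0 : u = 0
        · simp [hu0]
        · apply log_nonneg
          have : 0 < ‖u‖ := norm_pos_iff.mpr hu0
          simp only [zero_sub, norm_neg]
          rw [← div_eq_mul_inv, le_div_iff₀ this]
          simpa [habs] using hu
    · simp [hu]
  have hlog : log (1 / 2) ≤ log r := log_le_log (by norm_num) hr.le
  have := mul_le_mul_of_nonneg_left hlog hord
  linarith

open MeasureTheory Real in
lemma trunc_lower (f : ℂ → ℂ)
    (hc : ContinuousOn f (Metric.closedBall 0 1))
    (hd : DifferentiableOn ℂ f (Metric.ball 0 1))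
    (hne : ¬ ∀ z ∈ Metric.ball (0 : ℂ) 1, f z = 0) :
    ∃ C : ℝ, ∀ N : ℝ, C ≤ circleAverage (fun z => log (max ‖f z‖ (exp (-N)))) 0 1 := by
  obtain ⟨C, hC⟩ := jensen_lower f hd
  have ha : AnalyticOnNhd ℂ f (Metric.ball 0 1) := hd.analyticOnNhd Metric.isOpen_ball
  have hcod : ∀ᶠ x in Filter.codiscreteWithin (Metric.ball (0 : ℂ) 1), f x ≠ 0 := by
    rcases ha.eqOn_zero_or_eventually_ne_zero_of_preconnected
      (convex_ball (0 : ℂ) 1).isPreconnected with h | h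
    · exact absurd (fun z hz => h hz) hne
    · exact h
  refine ⟨C, fun N => ?_⟩
  set u : ℂ → ℝ := fun z => log (max ‖f z‖ (exp (-N))) with hu
  have huc : ContinuousOn u (Metric.closedBall 0 1) := by
    apply ContinuousOn.log
    · exact hc.norm.sup continuousOn_const
    · intro z _
      exact (lt_max_of_lt_right (exp_pos _)).ne'
  have hr : ∀ r ∈ Set.Ioo (1 / 2 : ℝ) 1, C ≤ circleAverage u 0 r := by
    rintro r ⟨hr, hr1⟩
    have hr0 : 0 < r := by linarith
    have habs : |r| = r := abs_of_pos hr0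
    have hsub : Metric.sphere (0 : ℂ) |r| ⊆ Metric.ball 0 1 := by
      rw [habs]; exact Metric.sphere_subset_closedBall.trans (Metric.closedBall_subset_ball hr1)
    have heq : (fun z => log ‖f z‖) =ᶠ[Filter.codiscreteWithin (Metric.sphere (0 : ℂ) |r|)]
        (fun z => min (log ‖f z‖) (u z)) := by
      filter_upwards [Filter.codiscreteWithin_mono hsub hcod] with z hz
      rw [min_eq_left]
      exact log_le_log (norm_pos_iff.mpr hz) (le_max_left _ _)
    have hint : CircleIntegrable (fun z => log ‖f z‖) 0 r :=
      (ha.mono hsub).meromorphicOn.circleIntegrable_log_norm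
    refine (hC r ⟨hr, hr1⟩).trans ?_
    rw [circleAverage_congr_codiscreteWithin heq hr0.ne']
    apply circleAverage_mono (hint.congr_codiscreteWithin heq)
    · apply ContinuousOn.circleIntegrable'
      exact huc.mono (hsub.trans Metric.ball_subset_closedBall)
    · intro x _
      exact min_le_right _ _
  have hcont : ContinuousOn (circleAverage u 0) (Set.Icc 0 1) := by
    apply ContinuousOn.circleAverage
    · apply huc.mono
      intro z hz
      simpa using hz.2
    · exact fun r hr => hr.1
  have h1 : Filter.Tendsto (circleAverage u 0) (nhdsWithin 1 (Set.Ioo (1 / 2) 1))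
      (nhds (circleAverage u 0 1)) :=
    (hcont 1 (by simp)).mono_left (nhdsWithin_mono _ (fun x hx => ⟨by linarith [hx.1], hx.2.le⟩))
  have : (nhdsWithin (1 : ℝ) (Set.Ioo (1 / 2) 1)).NeBot :=
    right_nhdsWithin_Ioo_neBot (by norm_num)
  exact ge_of_tendsto h1 (by filter_upwards [self_mem_nhdsWithin] with r h using hr r h)

open MeasureTheory Real in
/-- A function continuous on the closed unit disk and holomorphic inside, vanishing on a
subset of the unit circle of positive arc-length measure, vanishes identically. -/
theorem disk_algebra_uniqueness (f : ℂ → ℂ)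
    (hc : ContinuousOn f (Metric.closedBall 0 1))
    (hd : DifferentiableOn ℂ f (Metric.ball 0 1))
    (γ : Set ℝ) (hγ : γ ⊆ Set.Icc 0 (2 * π)) (hpos : 0 < volume γ)
    (hvan : ∀ t ∈ γ, f (Complex.exp (t * Complex.I)) = 0) :
    ∀ z ∈ Metric.closedBall (0 : ℂ) 1, f z = 0 := by
  by_cases hball : ∀ z ∈ Metric.ball (0 : ℂ) 1, f z = 0
  · have hcl : closure (Metric.ball (0 : ℂ) 1) = Metric.closedBall 0 1 :=
      closure_ball 0 one_ne_zero
    intro z hz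
    have h : Set.EqOn f (fun _ => 0) (Metric.closedBall (0 : ℂ) 1) :=
      Set.EqOn.of_subset_closure (s := Metric.ball (0 : ℂ) 1) hball hc continuousOn_const
        Metric.ball_subset_closedBall hcl.ge
    exact h hz
  exfalso
  obtain ⟨C, hC⟩ := trunc_lower f hc hd hball
  obtain ⟨M, hM⟩ := (isCompact_closedBall (0 : ℂ) 1).exists_bound_of_continuousOn hc
  have hmem : ∀ t : ℝ, circleMap 0 1 t ∈ Metric.closedBall (0 : ℂ) 1 := fun t => by simp
  have hh : Continuous (fun t : ℝ => f (circleMap 0 1 t)) :=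
    hc.comp_continuous (continuous_circleMap 0 1) hmem
  set Z : Set ℝ := {t | f (circleMap 0 1 t) = 0} with hZ
  have hZm : MeasurableSet Z := (isClosed_eq hh continuous_const).measurableSet
  set K : ℝ := log (max M 1)
  have hK : 0 ≤ K := log_nonneg (le_max_right _ _)
  set δ : ℝ := volume.real (Z ∩ Set.Ioc 0 (2 * π)) with hδ
  have hδpos : 0 < δ := by
    have hfin : volume (Z ∩ Set.Ioc 0 (2 * π)) ≠ ⊤ :=
      measure_ne_top_of_subset Set.inter_subset_right measure_Ioc_lt_top.ne
    refine ENNReal.toReal_pos ?_ hfin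
    intro h0
    have hsub : γ ⊆ (Z ∩ Set.Ioc 0 (2 * π)) ∪ {0} := by
      intro t ht
      by_cases h : t = 0
      · right; exact h
      · left
        refine ⟨?_, lt_of_le_of_ne (hγ ht).1 (Ne.symm h), (hγ ht).2⟩
        simpa [hZ, circleMap] using hvan t ht
    have : volume γ ≤ 0 := by
      refine (measure_mono hsub).trans ((measure_union_le _ _).trans ?_)
      simp [h0]
    exact absurd hpos (not_lt.mpr this)
  have key : ∀ N : ℝ, 0 ≤ N → C ≤ (2 * π)⁻¹ * (2 * π * K - N * δ) := by
    intro N hN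
    refine (hC N).trans ?_
    rw [circleAverage_def, smul_eq_mul]
    apply mul_le_mul_of_nonneg_left _ (by positivity)
    have hind : IntervalIntegrable (Z.indicator (fun _ => N)) volume 0 (2 * π) := by
      rw [intervalIntegrable_iff]
      refine IntegrableOn.indicator ?_ hZm
      exact (intervalIntegrable_const (c := N)).def'
    have hval : ∫ t in (0)..(2 * π), (K - Z.indicator (fun _ => N) t) = 2 * π * K - N * δ := by
      rw [intervalIntegral.integral_sub intervalIntegrable_const hind]
      congr 1
      · simp
      · rw [intervalIntegral.integral_of_le (by positivity), setIntegral_indicator hZm,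
          setIntegral_const, Set.inter_comm, smul_eq_mul, mul_comm]
    rw [← hval]
    apply intervalIntegral.integral_mono_on (by positivity)
    · apply Continuous.intervalIntegrable
      apply Continuous.log
      · exact hh.norm.max continuous_const
      · intro t
        exact (lt_max_of_lt_right (exp_pos _)).ne'
    · exact intervalIntegrable_const.sub hind
    · intro t _
      by_cases ht : t ∈ Z
      · have ht' : f (circleMap 0 1 t) = 0 := ht
        rw [Set.indicator_of_mem ht, ht', norm_zero, max_eq_right (exp_pos _).le, log_exp]
        linarith
      · rw [Set.indicator_of_notMem ht, sub_zero]
        apply log_le_log (lt_max_of_lt_right (exp_pos _))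
        apply max_le_max (hM _ (hmem t))
        exact exp_le_one_iff.mpr (by linarith)
  obtain ⟨n, hn⟩ := exists_nat_gt ((2 * π * K - 2 * π * C) / δ)
  rw [div_lt_iff₀ hδpos] at hn
  have := key n n.cast_nonneg
  rw [inv_mul_eq_div, le_div_iff₀ (by positivity)] at this
  linarith
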